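/- Under the same setup as the main steering result, with all imprecision parameters equal, ε_{b,y} = ε for all b, y: let χ = ∑_{x ∈ X} max_{a ∈ α} [∑_{b,y} c_{a,b,x,y}], assume 0 < β₀ < χ and 0 ≤ ε ≤ 1 − β₀/χ. If ∑_{a,b,x,y} c_{a,b,x,y} · Tr((A_{a|x} ⊗ P_{b|y}) ρ) ≤ β₀, then ∑_{a,b,x,y} c_{a,b,x,y} · Tr((A_{a|x} ⊗ B_{b|y}) ρ) ≤ β₀ − ε(2β₀ − χ) + 2√(ε(1−ε) β₀ (χ − β₀)). -/

import Mathlib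

open Matrix ComplexOrder Kronecker

/-- A positive semidefinite matrix is dominated by its trace times the identity. -/
theorem Matrix.PosSemidef.trace_smul_one_sub {n : Type*} [Fintype n] [DecidableEq n]
    {M : Matrix n n ℂ} (hM : M.PosSemidef) : (M.trace • (1 : Matrix n n ℂ) - M).PosSemidef := by
  have hH := hM.isHermitian
  set U : Matrix n n ℂ := (hH.eigenvectorUnitary : Matrix n n ℂ) with hU
  have hUU : U * Uᴴ = 1 := by
    rw [← star_eq_conjTranspose]
    exact Unitary.coe_mul_star_self hH.eigenvectorUnitary
  have hspec : M = U * diagonal (fun i => (hH.eigenvalues i : ℂ)) * Uᴴ := by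
    conv_lhs => rw [hH.spectral_theorem]
    rfl
  have htr : M.trace = ∑ i, (hH.eigenvalues i : ℂ) := hH.trace_eq_sum_eigenvalues
  have hD : (diagonal (fun i => M.trace - (hH.eigenvalues i : ℂ))).PosSemidef := by
    refine PosSemidef.diagonal fun i => ?_
    rw [htr, Pi.zero_apply, sub_nonneg]
    exact Finset.single_le_sum (f := fun i => (hH.eigenvalues i : ℂ))
      (fun j _ => by exact_mod_cast hM.eigenvalues_nonneg j) (Finset.mem_univ i)
  have h := hD.mul_mul_conjTranspose_same U
  have heq : M.trace • (1 : Matrix n n ℂ) - M =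
      U * diagonal (fun i => M.trace - (hH.eigenvalues i : ℂ)) * Uᴴ := by
    have hd : diagonal (fun i => M.trace - (hH.eigenvalues i : ℂ)) =
        M.trace • (1 : Matrix n n ℂ) - diagonal (fun i => (hH.eigenvalues i : ℂ)) := by
      rw [smul_one_eq_diagonal, diagonal_sub]
    rw [hd, Matrix.mul_sub, Matrix.sub_mul, ← hspec]
    simp [hUU]
  rw [heq]
  exact h

/-- The trace of a product of two positive semidefinite matrices is nonnegative. -/
theorem Matrix.PosSemidef.re_trace_mul_nonneg {n : Type*} [Fintype n]
    {M N : Matrix n n ℂ} (hM : M.PosSemidef) (hN : N.PosSemidef) : 0 ≤ ((M * N).trace).re := by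
  obtain ⟨k, w, rfl⟩ := posSemidef_iff_eq_sum_vecMulVec.mp hN
  rw [Matrix.mul_sum, trace_sum, Complex.re_sum]
  refine Finset.sum_nonneg fun i _ => ?_
  rw [mul_vecMulVec, trace_vecMulVec, dotProduct_comm]
  exact (Complex.nonneg_iff.mp (hM.dotProduct_mulVec_nonneg (w i))).1

/-- If the quadratic `s t² + k t + q` is nonnegative, with `s = F p` and `q ≤ (1 - F) w`, then its
value at `t = 1` is bounded by any `L p + m w` whose coefficients satisfy
`L (1 - F) + m F ≤ L m`. -/
theorem add_add_le_of_quadratic_nonneg {F p k q w L m : ℝ} (hF0 : 0 ≤ F)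
    (hp : 0 ≤ p) (hw : 0 ≤ w) (hq : q ≤ (1 - F) * w)
    (hquad : ∀ t : ℝ, 0 ≤ F * p * (t * t) + k * t + q)
    (hL : F ≤ L) (hm : 1 - F ≤ m) (hLm : L * (1 - F) + m * F ≤ L * m) :
    F * p + k + q ≤ L * p + m * w := by
  have hd : k ^ 2 - 4 * (F * p) * q ≤ 0 := discrim_le_zero hquad
  have h1 : F * p * q ≤ F * p * ((1 - F) * w) :=
    mul_le_mul_of_nonneg_left hq (mul_nonneg hF0 hp)
  have h2 : 0 ≤ (p * w) * (L * m - L * (1 - F) - m * F) :=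
    mul_nonneg (mul_nonneg hp hw) (by linarith)
  have h3 : k ^ 2 ≤ ((L - F) * p + (m - (1 - F)) * w) ^ 2 := by
    nlinarith [sq_nonneg ((L - F) * p - (m - (1 - F)) * w)]
  have h4 : 0 ≤ (L - F) * p + (m - (1 - F)) * w :=
    add_nonneg (mul_nonneg (by linarith) hp) (mul_nonneg (by linarith) hw)
  have h5 := abs_le_of_sq_le_sq h3 h4
  linarith [le_abs_self k]

/-- A positive functional evaluated at a state `B` of fidelity `F` with a pure state `P` is bounded
by its values at `P` and at the complementary projection. -/
theorem positive_functional_le_of_fidelity {n : Type*} [Fintype n] [DecidableEq n]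
    (φ : Matrix n n ℂ →ₗ[ℝ] ℝ) (hφ : ∀ M : Matrix n n ℂ, M.PosSemidef → 0 ≤ φ M)
    (v : n → ℂ) (hv : star v ⬝ᵥ v = 1) {B : Matrix n n ℂ} (hB : B.PosSemidef)
    (hBtr : B.trace = 1) {ε L m : ℝ}
    (hfid : 1 - ε ≤ ((B * vecMulVec v (star v)).trace).re)
    (hm0 : 0 ≤ m) (hL0 : 0 < L) (hmL : m ≤ L) (hmpos : m = 0 → 1 ≤ L)
    (hLm : L * ε + m * (1 - ε) ≤ L * m) :
    φ B ≤ (L - m) * φ (vecMulVec v (star v)) + m * φ 1 := by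
  set P : Matrix n n ℂ := vecMulVec v (star v) with hP
  set Q : Matrix n n ℂ := 1 - P with hQ
  have hPpos : P.PosSemidef := posSemidef_vecMulVec_self_star v
  have hPH : Pᴴ = P := hPpos.isHermitian
  have hQH : Qᴴ = Q := by simp [hQ, hPH]
  have hPP : P * P = P := by
    rw [hP, vecMulVec_mul_vecMulVec, hv, one_smul]
  have hQQ : Q * Q = Q := by
    simp [hQ, Matrix.mul_sub, Matrix.sub_mul, hPP]
  have hQpos : Q.PosSemidef := by
    have := posSemidef_conjTranspose_mul_self Q
    rwa [hQH, hQQ] at this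
  set F : ℝ := ((B * P).trace).re with hF
  have hz : (B * P).trace = star v ⬝ᵥ B *ᵥ v := by
    rw [hP, mul_vecMulVec, trace_vecMulVec, dotProduct_comm]
  have hz0 : 0 ≤ (B * P).trace := by
    rw [hz]; exact hB.dotProduct_mulVec_nonneg v
  have hFc : (B * P).trace = (F : ℂ) := by
    apply Complex.ext
    · simp [hF]
    · simpa using (Complex.nonneg_iff.mp hz0).2.symm
  have hF0 : 0 ≤ F := (Complex.nonneg_iff.mp hz0).1
  have hPBP : P * B * P = F • P := by
    have h : P * B * P = ((B * P).trace) • P := by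
      rw [hz, Matrix.mul_assoc, hP, mul_vecMulVec, vecMulVec_mul_vecMulVec,
        vecMulVec_smul]
    rw [h, hFc]
    ext i j
    simp
  have hQBQpos : (Q * B * Q).PosSemidef := by
    have := hB.mul_mul_conjTranspose_same Q
    rwa [hQH] at this
  have hQBQtr : (Q * B * Q).trace = ((1 - F : ℝ) : ℂ) := by
    rw [Matrix.mul_assoc, trace_mul_comm, Matrix.mul_assoc, hQQ, hQ, Matrix.mul_sub, trace_sub,
      Matrix.mul_one, hBtr, hFc]
    simp
  have hF1 : F ≤ 1 := by
    have := hQBQpos.trace_nonneg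
    rw [hQBQtr] at this
    have : (0 : ℝ) ≤ 1 - F := by exact_mod_cast this
    linarith
  have hq : φ (Q * B * Q) ≤ (1 - F) * φ Q := by
    have h := hQBQpos.trace_smul_one_sub.mul_mul_conjTranspose_same Q
    have heq : Q * ((Q * B * Q).trace • (1 : Matrix n n ℂ) - Q * B * Q) * Qᴴ =
        (1 - F) • Q - Q * B * Q := by
      have h1 : Q * (Q * B * Q) * Q = Q * B * Q := by
        calc Q * (Q * B * Q) * Q = (Q * Q) * B * (Q * Q) := by simp only [Matrix.mul_assoc]
          _ = Q * B * Q := by rw [hQQ]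
      rw [hQH, Matrix.mul_sub Q, Matrix.sub_mul _ _ Q, h1, hQBQtr, Matrix.mul_smul, Matrix.smul_mul,
        Matrix.mul_one, hQQ]
      congr 1
    rw [heq] at h
    have := hφ _ h
    rw [map_sub, map_smul, smul_eq_mul] at this
    linarith
  have hquad : ∀ t : ℝ, 0 ≤ F * φ P * (t * t) + φ (P * B * Q + Q * B * P) * t + φ (Q * B * Q) := by
    intro t
    have h := hB.mul_mul_conjTranspose_same (t • P + Q)
    have heq : (t • P + Q) * B * (t • P + Q)ᴴ =
        (t * t) • (P * B * P) + t • (P * B * Q + Q * B * P) + Q * B * Q := by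
      rw [conjTranspose_add, conjTranspose_smul, hPH, hQH, star_trivial]
      simp only [Matrix.add_mul, Matrix.mul_add, Matrix.smul_mul, Matrix.mul_smul, smul_add,
        smul_smul]
      abel
    rw [heq, hPBP] at h
    have := hφ _ h
    simp only [map_add, map_smul, smul_eq_mul] at this ⊢
    linarith
  have hBdec : φ B = F * φ P + φ (P * B * Q + Q * B * P) + φ (Q * B * Q) := by
    have : B = F • P + (P * B * Q + Q * B * P) + Q * B * Q := by
      rw [← hPBP, hQ]
      simp only [Matrix.mul_sub, Matrix.sub_mul, Matrix.mul_one, Matrix.one_mul]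
      abel
    conv_lhs => rw [this]
    simp only [map_add, map_smul, smul_eq_mul]
  have hLm' : L * (1 - F) + m * F ≤ L * m := by nlinarith
  have hFL : F ≤ L := by
    rcases hm0.eq_or_lt with h | h
    · linarith [hmpos h.symm]
    · nlinarith
  have hFm : 1 - F ≤ m := by
    by_contra! hcon
    nlinarith [mul_nonneg hm0 hF0]
  have hfin := add_add_le_of_quadratic_nonneg hF0 (hφ P hPpos) (hφ Q hQpos) hq hquad hFL hFm hLm'
  have hφQ : φ Q = φ 1 - φ P := by rw [hQ, map_sub]
  rw [hφQ] at hfin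
  rw [hBdec]
  linarith

/-- The functional `M ↦ Re Tr((A ⊗ M) ρ)`. -/
noncomputable def reTraceKronecker {m n : Type*} [Fintype m] [Fintype n]
    (A : Matrix m m ℂ) (ρ : Matrix (m × n) (m × n) ℂ) : Matrix n n ℂ →ₗ[ℝ] ℝ where
  toFun M := (((A ⊗ₖ M) * ρ).trace).re
  map_add' M N := by simp [kronecker_add, Matrix.add_mul]
  map_smul' r M := by simp [kronecker_smul]

/-- A total of nonnegative coefficients weighted by probability distributions is at most the sum of
the maximal coefficients. -/
theorem sum_mul_le_sum_sup' {X α : Type*} [Fintype X] [Fintype α] [Nonempty α]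
    (C q : α → X → ℝ) (hq : ∀ a x, 0 ≤ q a x) (hq1 : ∀ x, ∑ a, q a x = 1) :
    ∑ a, ∑ x, C a x * q a x ≤
      ∑ x, Finset.univ.sup' Finset.univ_nonempty (fun a => C a x) := by
  rw [Finset.sum_comm]
  refine Finset.sum_le_sum fun x _ => ?_
  calc ∑ a, C a x * q a x
      ≤ ∑ a, Finset.univ.sup' Finset.univ_nonempty (fun a => C a x) * q a x :=
        Finset.sum_le_sum fun a _ => mul_le_mul_of_nonneg_right
          (Finset.le_sup' (fun a => C a x) (Finset.mem_univ a)) (hq a x)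
    _ = _ := by rw [← Finset.mul_sum, hq1, mul_one]

/-- Coefficients of the tangent line, at the point `β₀ / χ`, to the curve bounding the lab value. -/
theorem exists_tangent_coefficients {ε β₀ χ : ℝ} (hε : 0 ≤ ε) (hβ₀pos : 0 < β₀) (hβ₀χ : β₀ < χ)
    (hεχ : ε ≤ 1 - β₀ / χ) :
    ∃ L m : ℝ, 0 ≤ m ∧ 0 < L ∧ m ≤ L ∧ (m = 0 → 1 ≤ L) ∧
      L * ε + m * (1 - ε) ≤ L * m ∧
      L * β₀ + m * (χ - β₀) =
        β₀ - ε * (2 * β₀ - χ) + 2 * Real.sqrt (ε * (1 - ε) * β₀ * (χ - β₀)) := by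
  have hχ0 : 0 < χ := hβ₀pos.trans hβ₀χ
  have hε1 : ε < 1 := by linarith [div_pos hβ₀pos hχ0]
  have hmul : ε * χ ≤ χ - β₀ := by
    have := mul_le_mul_of_nonneg_right hεχ hχ0.le
    rwa [sub_mul, one_mul, div_mul_cancel₀ _ hχ0.ne'] at this
  obtain ⟨e, he0, he⟩ : ∃ e : ℝ, 0 ≤ e ∧ e ^ 2 = ε := ⟨√ε, Real.sqrt_nonneg _, Real.sq_sqrt hε⟩
  obtain ⟨d, hd0, hd⟩ : ∃ d : ℝ, 0 < d ∧ d ^ 2 = 1 - ε :=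
    ⟨√(1 - ε), Real.sqrt_pos.2 (by linarith), Real.sq_sqrt (by linarith)⟩
  obtain ⟨u, hu0, hu⟩ : ∃ u : ℝ, 0 < u ∧ u ^ 2 = β₀ :=
    ⟨√β₀, Real.sqrt_pos.2 hβ₀pos, Real.sq_sqrt hβ₀pos.le⟩
  obtain ⟨w, hw0, hw⟩ : ∃ w : ℝ, 0 < w ∧ w ^ 2 = χ - β₀ :=
    ⟨√(χ - β₀), Real.sqrt_pos.2 (by linarith), Real.sq_sqrt (by linarith)⟩
  have hk : 0 < d * u + e * w := add_pos_of_pos_of_nonneg (mul_pos hd0 hu0) (mul_nonneg he0 hw0.le)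
  have hsqrt : Real.sqrt (ε * (1 - ε) * β₀ * (χ - β₀)) = e * d * u * w := by
    rw [← he, ← hw, ← hu, he, ← hd, ← he, ← mul_pow, ← mul_pow, ← mul_pow]
    exact Real.sqrt_sq (by positivity)
  refine ⟨d * (d * u + e * w) / u, e * (d * u + e * w) / w, by positivity, by positivity, ?_, ?_,
    ?_, ?_⟩
  · have : e * u ≤ d * w := by
      refine le_of_sq_le_sq ?_ (by positivity)
      rw [mul_pow, mul_pow, he, hu, hd, hw]
      nlinarith
    rw [div_le_div_iff₀ hw0 hu0]
    nlinarith
  · intro h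
    have h0 : e = 0 := by
      simpa [hk.ne', hw0.ne'] using h
    have hd1 : d ^ 2 = 1 := by rw [hd, ← he, h0]; norm_num
    rw [h0, le_div_iff₀ hu0]
    nlinarith
  · rw [← hd, ← he]
    apply le_of_eq
    field_simp
    ring
  · rw [hsqrt]
    have h1 : d * (d * u + e * w) / u * β₀ + e * (d * u + e * w) / w * (χ - β₀)
        = (d * u + e * w) ^ 2 := by
      rw [← hw, ← hu]
      field_simp
    have h2 : (d * u + e * w) ^ 2 = d ^ 2 * u ^ 2 + e ^ 2 * w ^ 2 + 2 * (e * d * u * w) := by ring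
    rw [h1, h2, hd, hu, he, hw]
    ring

/-- Corrected steering bound with all imprecision parameters equal to `ε`:
with `χ = ∑_x max_a ∑_{b,y} c_{abxy}`, `0 < β₀ < χ` and `0 ≤ ε ≤ 1 − β₀/χ`,
the lab value is at most `β₀ − ε(2β₀ − χ) + 2√(ε(1−ε)β₀(χ−β₀))`. -/
theorem corrected_steering_bound_equal_imprecision
    {X Y α β : Type*} [Fintype X] [Fintype Y] [Fintype α] [Fintype β]
    [Nonempty X] [Nonempty Y] [Nonempty α] [Nonempty β]
    (dA dB : ℕ) (hdA : 1 ≤ dA) (hdB : 1 ≤ dB)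
    (A : X → α → Matrix (Fin dA) (Fin dA) ℂ)
    (hApos : ∀ x a, (A x a).PosSemidef)
    (hAsum : ∀ x, ∑ a, A x a = 1)
    (ψ : Y → β → Fin dB → ℂ)
    (hψ : ∀ y b, star (ψ y b) ⬝ᵥ ψ y b = 1)
    (B : Y → β → Matrix (Fin dB) (Fin dB) ℂ)
    (hBpos : ∀ y b, (B y b).PosSemidef)
    (hBtr : ∀ y b, (B y b).trace = 1)
    (ε : ℝ) (hε : 0 ≤ ε)
    (hfid : ∀ y b, 1 - ε ≤ ((B y b * vecMulVec (ψ y b) (star (ψ y b))).trace).re)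
    (c : α → β → X → Y → ℝ) (hc : ∀ a b x y, 0 ≤ c a b x y)
    (ρ : Matrix (Fin dA × Fin dB) (Fin dA × Fin dB) ℂ)
    (hρ : ρ.PosSemidef) (hρtr : ρ.trace = 1)
    (β₀ χ : ℝ)
    (hχ : χ = ∑ x, Finset.univ.sup' Finset.univ_nonempty
        (fun a => ∑ b, ∑ y, c a b x y))
    (hβ₀pos : 0 < β₀) (hβ₀χ : β₀ < χ) (hεχ : ε ≤ 1 - β₀ / χ)
    (htarget : ∑ a, ∑ b, ∑ x, ∑ y, c a b x y *
        (((A x a ⊗ₖ vecMulVec (ψ y b) (star (ψ y b))) * ρ).trace).re ≤ β₀) :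
    ∑ a, ∑ b, ∑ x, ∑ y, c a b x y * (((A x a ⊗ₖ B y b) * ρ).trace).re ≤
      β₀ - ε * (2 * β₀ - χ) + 2 * Real.sqrt (ε * (1 - ε) * β₀ * (χ - β₀)) := by
  obtain ⟨L, m, hm0, hL0, hmL, hmpos, hLm, hval⟩ :=
    exists_tangent_coefficients hε hβ₀pos hβ₀χ hεχ
  have hpos : ∀ a x, ∀ M : Matrix (Fin dB) (Fin dB) ℂ, M.PosSemidef →
      0 ≤ reTraceKronecker (A x a) ρ M := fun a x M hM =>
    ((hApos x a).kronecker hM).re_trace_mul_nonneg hρ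
  have hbound : ∀ a b x y, reTraceKronecker (A x a) ρ (B y b) ≤
      (L - m) * reTraceKronecker (A x a) ρ (vecMulVec (ψ y b) (star (ψ y b))) +
        m * reTraceKronecker (A x a) ρ 1 := fun a b x y =>
    positive_functional_le_of_fidelity _ (hpos a x) (ψ y b) (hψ y b) (hBpos y b) (hBtr y b)
      (hfid y b) hm0 hL0 hmL hmpos hLm
  have hq1 : ∀ x, ∑ a, reTraceKronecker (A x a) ρ 1 = 1 := by
    intro x
    have h : ∑ a, (A x a ⊗ₖ (1 : Matrix (Fin dB) (Fin dB) ℂ)) = 1 := by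
      rw [← one_kronecker_one, ← hAsum x]
      ext i j
      simp [Matrix.sum_apply, Finset.sum_mul]
    calc ∑ a, reTraceKronecker (A x a) ρ 1
        = (((∑ a, (A x a ⊗ₖ (1 : Matrix (Fin dB) (Fin dB) ℂ))) * ρ).trace).re := by
          rw [Finset.sum_mul, trace_sum, Complex.re_sum]
          rfl
      _ = 1 := by rw [h, Matrix.one_mul, hρtr, Complex.one_re]
  have hW : ∑ a, ∑ b, ∑ x, ∑ y, c a b x y * reTraceKronecker (A x a) ρ 1 ≤ χ := by
    rw [hχ]
    refine le_trans (le_of_eq ?_) (sum_mul_le_sum_sup' (fun a x => ∑ b, ∑ y, c a b x y)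
      (fun a x => reTraceKronecker (A x a) ρ 1) (fun a x => hpos a x 1 PosSemidef.one) hq1)
    refine Finset.sum_congr rfl fun a _ => ?_
    rw [Finset.sum_comm]
    simp only [Finset.sum_mul]
  calc ∑ a, ∑ b, ∑ x, ∑ y, c a b x y * (((A x a ⊗ₖ B y b) * ρ).trace).re
      ≤ ∑ a, ∑ b, ∑ x, ∑ y, ((L - m) * (c a b x y *
          (((A x a ⊗ₖ vecMulVec (ψ y b) (star (ψ y b))) * ρ).trace).re) +
          m * (c a b x y * reTraceKronecker (A x a) ρ 1)) := by
        refine Finset.sum_le_sum fun a _ => Finset.sum_le_sum fun b _ =>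
          Finset.sum_le_sum fun x _ => Finset.sum_le_sum fun y _ => ?_
        refine (mul_le_mul_of_nonneg_left (hbound a b x y) (hc a b x y)).trans (le_of_eq ?_)
        change c a b x y * ((L - m) *
          (((A x a ⊗ₖ vecMulVec (ψ y b) (star (ψ y b))) * ρ).trace).re + _) = _
        ring
    _ = (L - m) * (∑ a, ∑ b, ∑ x, ∑ y, c a b x y *
          (((A x a ⊗ₖ vecMulVec (ψ y b) (star (ψ y b))) * ρ).trace).re) +
          m * ∑ a, ∑ b, ∑ x, ∑ y, c a b x y * reTraceKronecker (A x a) ρ 1 := by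
        simp only [Finset.sum_add_distrib, Finset.mul_sum]
    _ ≤ (L - m) * β₀ + m * χ := add_le_add
        (mul_le_mul_of_nonneg_left htarget (sub_nonneg.2 hmL)) (mul_le_mul_of_nonneg_left hW hm0)
    _ = L * β₀ + m * (χ - β₀) := by ring
    _ = _ := hval
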